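/- For every n ∈ ℕ and every ζ ∈ ℝ, the n-th derivative of g(ζ) = exp(−ζ²/2) satisfies |g^{(n)}(ζ)| ≤ C₀ · exp(−ζ²/4) · √(n!), for an absolute constant C₀ ≤ 1.0866. In particular |g^{(n)}(ζ)| ≤ C₀ √(n!) for all ζ. -/

import Mathlib

open Finset

namespace CramerBound

/-- The Taylor coefficients of `(1 - t ^ 2) ^ (-1 / 4)`. -/
noncomputable def quarterCoeff : ℕ → ℝ
  | 0 => 1
  | 1 => 0
  | n + 2 => (n + 1 / 2) / (n + 2) * quarterCoeff n

/-- The Taylor coefficients in `t` of `(1 - t ^ 2) ^ (-1 / 4) * exp (y * t / (1 + t))`, as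
functions of `y`; their square as power series is Mehler's kernel on the diagonal. -/
noncomputable def mehlerRoot : ℕ → ℝ → ℝ
  | 0 => fun _ => 1
  | n + 1 => fun y =>
      quarterCoeff (n + 1) + quarterCoeff n - mehlerRoot n y + ∫ s in (0 : ℝ)..y, mehlerRoot n s

/-- The derivative of `mehlerRoot n`. -/
noncomputable def mehlerRootDeriv : ℕ → ℝ → ℝ
  | 0 => fun _ => 0
  | n + 1 => fun y => mehlerRoot n y - mehlerRootDeriv n y

/-- The probabilists' Hermite polynomials, as functions on `ℝ`. -/
noncomputable def hermiteFun : ℕ → ℝ → ℝ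
  | 0 => fun _ => 1
  | 1 => fun x => x
  | n + 2 => fun x => x * hermiteFun (n + 1) x - (n + 1) * hermiteFun n x

/-- The Taylor coefficients of Mehler's kernel on the diagonal. -/
noncomputable def mehlerDiag (n : ℕ) (y : ℝ) : ℝ :=
  ∑ ij ∈ antidiagonal n, mehlerRoot ij.1 y * mehlerRoot ij.2 y

theorem continuous_mehlerRoot (n : ℕ) : Continuous (mehlerRoot n) := by
  induction n with
  | zero => exact continuous_const
  | succ n ih =>
    exact (continuous_const.sub ih).add
      (intervalIntegral.continuous_primitive (fun a b => ih.intervalIntegrable a b) 0)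

theorem hasDerivAt_mehlerRoot (n : ℕ) (y : ℝ) :
    HasDerivAt (mehlerRoot n) (mehlerRootDeriv n y) y := by
  induction n with
  | zero => exact hasDerivAt_const y 1
  | succ n ih =>
    have h := (ih.const_sub (quarterCoeff (n + 1) + quarterCoeff n)).add
      ((continuous_mehlerRoot n).integral_hasStrictDerivAt 0 y).hasDerivAt
    refine h.congr_deriv ?_
    simp only [mehlerRootDeriv]
    ring

theorem mehlerRoot_eq (n : ℕ) (y : ℝ) :
    mehlerRoot n y = mehlerRootDeriv n y + mehlerRootDeriv (n + 1) y := by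
  simp [mehlerRootDeriv]

theorem mehlerRoot_zero (n : ℕ) : mehlerRoot n 0 = quarterCoeff n := by
  induction n with
  | zero => rfl
  | succ n ih => simp [mehlerRoot, ih]

theorem hasDerivAt_hermiteFun_succ (n : ℕ) (x : ℝ) :
    HasDerivAt (hermiteFun (n + 1)) ((n + 1) * hermiteFun n x) x := by
  induction n using Nat.strong_induction_on with
  | _ n ih =>
    match n with
    | 0 => simpa [hermiteFun] using hasDerivAt_id' x
    | 1 =>
      have h := ((hasDerivAt_id x).mul (hasDerivAt_id x)).sub_const 1
      refine (h.congr_deriv ?_).congr_of_eventuallyEq (.of_forall fun t => ?_)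
      · simp [hermiteFun]; ring
      · simp [hermiteFun]
    | n + 2 =>
      have h := ((hasDerivAt_id x).mul (ih (n + 1) (by omega))).sub
        ((ih n (by omega)).const_mul ((n : ℝ) + 2))
      refine (h.congr_deriv ?_).congr_of_eventuallyEq (.of_forall fun t => ?_)
      · simp [hermiteFun]; ring
      · simp only [hermiteFun, Pi.sub_apply, Pi.mul_apply, id]
        push_cast
        ring

theorem iteratedDeriv_gaussian (n : ℕ) :
    iteratedDeriv n (fun t : ℝ => Real.exp (-(t ^ 2) / 2)) =
      fun x => (-1) ^ n * hermiteFun n x * Real.exp (-(x ^ 2) / 2) := by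
  have hg (x : ℝ) : HasDerivAt (fun t : ℝ => Real.exp (-(t ^ 2) / 2))
      (Real.exp (-(x ^ 2) / 2) * -x) x := by
    refine HasDerivAt.exp ?_
    refine (((hasDerivAt_pow 2 x).neg).div_const 2).congr_deriv ?_
    simp; ring
  induction n with
  | zero => simp [hermiteFun]
  | succ n ih =>
    rw [iteratedDeriv_succ, ih]
    funext x
    match n with
    | 0 =>
      simp only [pow_zero, hermiteFun, one_mul, (hg x).deriv]
      ring
    | n + 1 =>
      have h := ((hasDerivAt_hermiteFun_succ n x).const_mul ((-1) ^ (n + 1))).mul (hg x)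
      refine h.deriv.trans ?_
      simp only [hermiteFun]
      ring

theorem hasDerivAt_sum_sq_mehlerRoot (n : ℕ) (y : ℝ) :
    HasDerivAt (fun y => Real.exp (-y) * ∑ k ∈ range n, mehlerRoot k y ^ 2)
      (-(Real.exp (-y) * mehlerRootDeriv n y ^ 2)) y := by
  have h1 : HasDerivAt (fun y => ∑ k ∈ range n, mehlerRoot k y ^ 2)
      (∑ k ∈ range n, 2 * mehlerRoot k y * mehlerRootDeriv k y) y := by
    refine HasDerivAt.fun_sum fun k _ => ?_
    simpa using (hasDerivAt_mehlerRoot k y).fun_pow 2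
  refine ((hasDerivAt_neg y).exp.mul h1).congr_deriv ?_
  have h2 : ∑ k ∈ range n, 2 * mehlerRoot k y * mehlerRootDeriv k y -
      ∑ k ∈ range n, mehlerRoot k y ^ 2 = -mehlerRootDeriv n y ^ 2 := by
    clear h1
    induction n with
    | zero => simp [mehlerRootDeriv]
    | succ n ih =>
      rw [sum_range_succ, sum_range_succ, mehlerRoot_eq n y]
      linear_combination ih
  linear_combination Real.exp (-y) * h2

theorem sum_sq_quarterCoeff_le (n : ℕ) :
    ∑ k ∈ range n, quarterCoeff k ^ 2 ≤ 1.0866 ^ 2 := by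
  let T : ℕ → ℝ := fun n => ∑ k ∈ range n, quarterCoeff k ^ 2 +
    (n + 4 / 5) * quarterCoeff n ^ 2 + (n + 9 / 5) * quarterCoeff (n + 1) ^ 2
  have hstep (n : ℕ) (hn : 12 ≤ n) : T (n + 1) ≤ T n := by
    have hn' : (12 : ℝ) ≤ n := by exact_mod_cast hn
    have hc : 1 + (n + 14 / 5) * ((n + 1 / 2) / (n + 2)) ^ 2 ≤ (n + 4 / 5 : ℝ) := by
      rw [div_pow, ← mul_div_assoc, ← le_sub_iff_add_le', div_le_iff₀ (by positivity)]
      nlinarith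
    have := mul_le_mul_of_nonneg_right hc (sq_nonneg (quarterCoeff n))
    simp only [T, sum_range_succ, quarterCoeff]
    push_cast
    linarith
  have h12 : T 12 ≤ 1.0866 ^ 2 := by
    simp only [T, sum_range_succ, sum_range_zero, quarterCoeff]
    norm_num
  have hT (m : ℕ) : T (12 + m) ≤ 1.0866 ^ 2 := by
    induction m with
    | zero => exact h12
    | succ m ih => exact (hstep (12 + m) (by omega)).trans ih
  calc ∑ k ∈ range n, quarterCoeff k ^ 2
      ≤ ∑ k ∈ range (12 + n), quarterCoeff k ^ 2 :=
        sum_le_sum_of_subset_of_nonneg (range_mono (by omega)) fun _ _ _ => sq_nonneg _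
    _ ≤ T (12 + n) := by
        simp only [T]
        have h1 : 0 ≤ ((12 + n : ℕ) + 4 / 5 : ℝ) * quarterCoeff (12 + n) ^ 2 := by positivity
        have h2 : 0 ≤ ((12 + n : ℕ) + 9 / 5 : ℝ) * quarterCoeff (12 + n + 1) ^ 2 := by positivity
        linarith
    _ ≤ 1.0866 ^ 2 := hT n

theorem sum_sq_mehlerRoot_le (n : ℕ) {y : ℝ} (hy : 0 ≤ y) :
    Real.exp (-y) * ∑ k ∈ range n, mehlerRoot k y ^ 2 ≤ 1.0866 ^ 2 := by
  have hanti : Antitone fun y => Real.exp (-y) * ∑ k ∈ range n, mehlerRoot k y ^ 2 :=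
    antitone_of_deriv_nonpos (fun y => (hasDerivAt_sum_sq_mehlerRoot n y).differentiableAt)
      fun y => by
        rw [(hasDerivAt_sum_sq_mehlerRoot n y).deriv, neg_nonpos]
        positivity
  refine (hanti hy).trans ?_
  simpa [mehlerRoot_zero] using sum_sq_quarterCoeff_le n

theorem mehlerDiag_le (n : ℕ) (y : ℝ) :
    mehlerDiag n y ≤ ∑ k ∈ range (n + 1), mehlerRoot k y ^ 2 := by
  have h1 : ∑ ij ∈ antidiagonal n, mehlerRoot ij.2 y ^ 2 =
      ∑ ij ∈ antidiagonal n, mehlerRoot ij.1 y ^ 2 :=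
    Nat.sum_antidiagonal_swap (f := fun ij : ℕ × ℕ => mehlerRoot ij.1 y ^ 2)
  have h2 : mehlerDiag n y ≤ ∑ ij ∈ antidiagonal n,
      (mehlerRoot ij.1 y ^ 2 / 2 + mehlerRoot ij.2 y ^ 2 / 2) :=
    sum_le_sum fun ij _ => by nlinarith [sq_nonneg (mehlerRoot ij.1 y - mehlerRoot ij.2 y)]
  rw [sum_add_distrib, ← sum_div, ← sum_div, h1, add_halves,
    Nat.sum_antidiagonal_eq_sum_range_succ_mk] at h2
  exact h2

theorem hasDerivAt_mehlerDiag (n : ℕ) (y : ℝ) :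
    HasDerivAt (mehlerDiag n)
      (2 * ∑ ij ∈ antidiagonal n, mehlerRootDeriv ij.1 y * mehlerRoot ij.2 y) y := by
  have h : HasDerivAt (mehlerDiag n) (∑ ij ∈ antidiagonal n,
      (mehlerRootDeriv ij.1 y * mehlerRoot ij.2 y + mehlerRoot ij.1 y * mehlerRootDeriv ij.2 y)) y :=
    HasDerivAt.fun_sum fun ij _ =>
      (hasDerivAt_mehlerRoot ij.1 y).mul (hasDerivAt_mehlerRoot ij.2 y)
  refine h.congr_deriv ?_
  rw [sum_add_distrib, two_mul]
  congr 1
  rw [← Nat.sum_antidiagonal_swap]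
  exact sum_congr rfl fun _ _ => mul_comm _ _

theorem sum_deriv_mehlerRoot_succ (n : ℕ) (y : ℝ) :
    ∑ ij ∈ antidiagonal (n + 1), mehlerRootDeriv ij.1 y * mehlerRoot ij.2 y +
      ∑ ij ∈ antidiagonal n, mehlerRootDeriv ij.1 y * mehlerRoot ij.2 y = mehlerDiag n y := by
  rw [Nat.sum_antidiagonal_succ]
  simp only [mehlerRootDeriv, mehlerDiag, zero_mul, zero_add, ← sum_add_distrib]
  exact sum_congr rfl fun _ _ => by ring

theorem mehlerDiag_zero_succ_succ (n : ℕ) :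
    (n + 2) * mehlerDiag (n + 2) 0 = (n + 1) * mehlerDiag n 0 := by
  have key (m : ℕ) : (m : ℝ) * mehlerDiag m 0 =
      2 * ∑ ij ∈ antidiagonal m, ij.1 * (quarterCoeff ij.1 * quarterCoeff ij.2) := by
    have h : ∑ ij ∈ antidiagonal m, (ij.2 : ℝ) * (quarterCoeff ij.1 * quarterCoeff ij.2) =
        ∑ ij ∈ antidiagonal m, ij.1 * (quarterCoeff ij.1 * quarterCoeff ij.2) := by
      rw [← Nat.sum_antidiagonal_swap]
      exact sum_congr rfl fun _ _ => by simp [mul_comm]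
    rw [two_mul]
    nth_rewrite 1 [← h]
    rw [← sum_add_distrib, mehlerDiag, mul_sum]
    refine sum_congr rfl fun ij hij => ?_
    have hm : (m : ℝ) = ij.1 + ij.2 := by exact_mod_cast (mem_antidiagonal.1 hij).symm
    rw [hm, mehlerRoot_zero, mehlerRoot_zero]
    ring
  have h2 := key (n + 2)
  rw [Nat.sum_antidiagonal_succ, Nat.sum_antidiagonal_succ] at h2
  have h3 : ∑ ij ∈ antidiagonal n, ((ij.1 + 1 + 1 : ℕ) : ℝ) *
      (quarterCoeff (ij.1 + 1 + 1) * quarterCoeff ij.2) =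
      ∑ ij ∈ antidiagonal n, ij.1 * (quarterCoeff ij.1 * quarterCoeff ij.2) +
      mehlerDiag n 0 / 2 := by
    rw [mehlerDiag, sum_div, ← sum_add_distrib]
    refine sum_congr rfl fun ij _ => ?_
    have : (ij.1 + 2 : ℝ) ≠ 0 := by positivity
    simp only [quarterCoeff, mehlerRoot_zero]
    push_cast
    field_simp
    ring
  simp only [h3] at h2
  simp only [quarterCoeff] at h2
  push_cast at h2
  linear_combination h2 - key n

theorem hermiteFun_zero_sq (n : ℕ) :
    hermiteFun n 0 ^ 2 / n.factorial = mehlerDiag n 0 := by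
  induction n using Nat.twoStepInduction with
  | zero => simp [hermiteFun, mehlerDiag, mehlerRoot]
  | one =>
    simp [hermiteFun, mehlerDiag, mehlerRoot_zero, Nat.sum_antidiagonal_succ, quarterCoeff]
  | more n ih _ =>
    have h := mehlerDiag_zero_succ_succ n
    have h2 : (n + 2 : ℝ) ≠ 0 := by positivity
    refine mul_left_cancel₀ h2 (Eq.trans ?_ h.symm)
    rw [← ih]
    have h1 : (n + 1 : ℝ) ≠ 0 := by positivity
    have hf : (n.factorial : ℝ) ≠ 0 := by positivity
    simp only [hermiteFun, Nat.factorial_succ]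
    push_cast
    field_simp
    ring

theorem hasDerivAt_hermiteFun_sq_add (n : ℕ) (x : ℝ) :
    HasDerivAt (fun x => hermiteFun (n + 1) x ^ 2 / (n + 1).factorial +
      hermiteFun n x ^ 2 / n.factorial) (2 * x * (hermiteFun n x ^ 2 / n.factorial)) x := by
  have hA := ((hasDerivAt_hermiteFun_succ n x).pow 2).div_const ((n + 1).factorial : ℝ)
  match n with
  | 0 =>
    refine (hA.add (hasDerivAt_const x (1 : ℝ))).congr_of_eventuallyEq
      (.of_forall fun t => ?_) |>.congr_deriv ?_ <;> simp [hermiteFun]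
  | n + 1 =>
    have hB := ((hasDerivAt_hermiteFun_succ n x).pow 2).div_const ((n + 1).factorial : ℝ)
    refine (hA.add hB).congr_deriv ?_
    have hf : (n.factorial : ℝ) ≠ 0 := by positivity
    have h1 : (n + 1 : ℝ) ≠ 0 := by positivity
    have h2 : (n + 1 + 1 : ℝ) ≠ 0 := by positivity
    simp only [hermiteFun, Nat.factorial_succ]
    push_cast
    field_simp
    ring

/-- Mehler's formula on the diagonal. -/
theorem hermiteFun_sq_div_factorial (n : ℕ) (x : ℝ) :
    hermiteFun n x ^ 2 / n.factorial = mehlerDiag n (x ^ 2 / 2) := by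
  induction n generalizing x with
  | zero => simp [hermiteFun, mehlerDiag, mehlerRoot]
  | succ n ih =>
    have hsq (m : ℕ) (x : ℝ) : HasDerivAt (fun x => mehlerDiag m (x ^ 2 / 2))
        ((2 * ∑ ij ∈ antidiagonal m,
          mehlerRootDeriv ij.1 (x ^ 2 / 2) * mehlerRoot ij.2 (x ^ 2 / 2)) * x) x := by
      have h : HasDerivAt (fun x : ℝ => x ^ 2 / 2) x x := by
        simpa using (hasDerivAt_pow 2 x).div_const 2
      exact (hasDerivAt_mehlerDiag m (x ^ 2 / 2)).comp x h
    let w : ℝ → ℝ := fun x => (hermiteFun (n + 1) x ^ 2 / (n + 1).factorial +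
      hermiteFun n x ^ 2 / n.factorial) -
      (mehlerDiag (n + 1) (x ^ 2 / 2) + mehlerDiag n (x ^ 2 / 2))
    have hw (x : ℝ) : HasDerivAt w 0 x := by
      refine ((hasDerivAt_hermiteFun_sq_add n x).sub
        ((hsq (n + 1) x).add (hsq n x))).congr_deriv ?_
      rw [ih]
      linear_combination -2 * x * sum_deriv_mehlerRoot_succ n (x ^ 2 / 2)
    have hconst := is_const_of_deriv_eq_zero (fun x => (hw x).differentiableAt)
      (fun x => (hw x).deriv) x 0
    have h0 : w 0 = 0 := by simp [w, hermiteFun_zero_sq]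
    have hx : w x = 0 := hconst.trans h0
    simp only [w] at hx
    linear_combination hx - ih x

theorem abs_hermiteFun_mul_exp_le (n : ℕ) (x : ℝ) :
    |hermiteFun n x| * Real.exp (-(x ^ 2) / 4) ≤ 1.0866 * Real.sqrt n.factorial := by
  have h := (mul_le_mul_of_nonneg_left (mehlerDiag_le n (x ^ 2 / 2))
    (Real.exp_nonneg (-(x ^ 2 / 2)))).trans (sum_sq_mehlerRoot_le (n + 1) (by positivity))
  rw [← hermiteFun_sq_div_factorial, ← mul_div_assoc, div_le_iff₀ (by positivity)] at h
  refine abs_le_of_sq_le_sq ?_ (by positivity) |> (le_abs_self _).trans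
  rw [mul_pow, mul_pow, sq_abs, Real.sq_sqrt (by positivity), ← Real.exp_nat_mul, mul_comm]
  convert h using 3
  push_cast
  ring

end CramerBound


/-- for `g(ζ) = exp(−ζ²/2)`, every derivative satisfies
`|g^{(n)}(ζ)| ≤ C₀ exp(−ζ²/4) √(n!)` with an absolute constant `C₀ ≤ 1.0866`;
in particular `|g^{(n)}(ζ)| ≤ C₀ √(n!)`. -/
theorem stmt_4 :
    ∃ C₀ : ℝ, 0 ≤ C₀ ∧ C₀ ≤ 1.0866 ∧
      ∀ (n : ℕ) (ζ : ℝ),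
        |iteratedDeriv n (fun t : ℝ => Real.exp (-(t ^ 2) / 2)) ζ| ≤
            C₀ * Real.exp (-(ζ ^ 2) / 4) * Real.sqrt (n.factorial : ℝ) ∧
        |iteratedDeriv n (fun t : ℝ => Real.exp (-(t ^ 2) / 2)) ζ| ≤
            C₀ * Real.sqrt (n.factorial : ℝ) := by
  have main (n : ℕ) (ζ : ℝ) : |iteratedDeriv n (fun t : ℝ => Real.exp (-(t ^ 2) / 2)) ζ| ≤
      1.0866 * Real.exp (-(ζ ^ 2) / 4) * Real.sqrt (n.factorial : ℝ) := by
    have hexp : Real.exp (-(ζ ^ 2) / 2) = Real.exp (-(ζ ^ 2) / 4) * Real.exp (-(ζ ^ 2) / 4) := by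
      rw [← Real.exp_add]
      ring_nf
    have h := mul_le_mul_of_nonneg_right (CramerBound.abs_hermiteFun_mul_exp_le n ζ)
      (Real.exp_nonneg (-(ζ ^ 2) / 4))
    rw [CramerBound.iteratedDeriv_gaussian]
    simp only [abs_mul, abs_pow, abs_neg, abs_one, one_pow, one_mul, Real.abs_exp, hexp]
    linarith
  refine ⟨1.0866, by norm_num, le_rfl, fun n ζ => ⟨main n ζ, (main n ζ).trans ?_⟩⟩
  have h1 : Real.exp (-(ζ ^ 2) / 4) ≤ 1 := Real.exp_le_one_iff.2 (by nlinarith [sq_nonneg ζ])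
  gcongr
  linarith
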